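/- arXiv:2206.05349 — 10 statements merged into one kernel-verified Lean document; each statement's English description precedes it below -/
import Mathlib

section
/- Let p ≥ 3 be a prime, let a, b ∈ F_p with a ≠ 0 and a ≠ 1, let f = a·x + b ∈ F_p[x], and let r be the multiplicative order of a in F_p^×. Let d ≥ 1 be an integer with d ≡ 1 (mod r). Then the set C_d(f) = {g ∈ F_p[x] : deg g = d and f ∘ g = g ∘ f} is finite and has exactly (p−1)·p^((d−1)/r) elements. -/
open Polynomial

namespace Polynomial

/-- Over a field with `q` elements there are `(q - 1) * q ^ m` polynomials of degree `m`. -/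
theorem finite_and_ncard_degree_eq (F : Type*) [Field F] [Finite F] (m : ℕ) :
    {q : F[X] | q.degree = m}.Finite ∧
      {q : F[X] | q.degree = m}.ncard = (Nat.card F - 1) * Nat.card F ^ m := by
  have hfin (n : ℕ) : ((degreeLT F n : Submodule F F[X]) : Set F[X]).Finite :=
    Finite.of_equiv _ (degreeLTEquiv F n).toEquiv.symm
  have hcard (n : ℕ) : ((degreeLT F n : Submodule F F[X]) : Set F[X]).ncard = Nat.card F ^ n := by
    rw [← Nat.card_coe_set_eq]
    simpa [Nat.card_fun] using Nat.card_congr (degreeLTEquiv F n).toEquiv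
  have hdiff : {q : F[X] | q.degree = m} =
      ((degreeLT F (m + 1) : Submodule F F[X]) : Set F[X]) \ (degreeLT F m : Submodule F F[X]) := by
    ext q
    simp only [Set.mem_ofPred_eq, Set.mem_sdiff, SetLike.mem_coe, mem_degreeLT, not_lt]
    rw [le_antisymm_iff, degree_le_iff_coeff_zero, degree_lt_iff_coeff_zero]
    simp
  rw [hdiff]
  refine ⟨(hfin _).sdiff, ?_⟩
  rw [Set.ncard_sdiff (degreeLT_mono (Nat.le_succ m)) (hfin m), hcard, hcard, pow_succ',
    Nat.sub_one_mul]

section Field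

variable {F : Type*} [Field F]

/-- A polynomial `h` with `h(a x) = a h(x)` has the form `x q(x ^ r)`, `r` the order of `a`. -/
theorem exists_eq_X_mul_expand_of_comp_C_mul_X {a : F} (ha0 : a ≠ 0) (ha1 : a ≠ 1)
    (hr : 0 < orderOf a) {h : F[X]} (hh : h.comp (C a * X) = C a * h) :
    ∃ q : F[X], h = X * expand F (orderOf a) q := by
  have hcoeff (n : ℕ) (hn : h.coeff n ≠ 0) : a ^ n = a := by
    have := congrArg (fun q : F[X] => q.coeff n) hh
    simp only [comp_C_mul_X_coeff, coeff_C_mul] at this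
    exact mul_left_cancel₀ hn (by rw [this, mul_comm])
  have h0 : h.coeff 0 = 0 := by
    by_contra h0
    exact ha1 (by simpa using (hcoeff 0 h0).symm)
  refine ⟨contract (orderOf a) h.divX, ?_⟩
  have : expand F (orderOf a) (contract (orderOf a) h.divX) = h.divX := by
    ext n
    rw [coeff_expand hr]
    split_ifs with hn
    · rw [coeff_contract hr.ne', Nat.div_mul_cancel hn]
    · by_contra hne
      rw [coeff_divX] at hne
      have := hcoeff (n + 1) (Ne.symm hne)
      rw [pow_succ, mul_eq_right₀ ha0] at this
      exact hn (orderOf_dvd_of_pow_eq_one this)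
  rw [this]
  conv_lhs => rw [← X_mul_divX_add h, h0, C_0, add_zero]

theorem comp_X_add_C_comp_X_sub_C (g : F[X]) (c : F) :
    (g.comp (X + C c)).comp (X - C c) = g := by
  simp [comp_assoc]

theorem comp_X_sub_C_comp_X_add_C (g : F[X]) (c : F) :
    (g.comp (X - C c)).comp (X + C c) = g := by
  simp [comp_assoc]

/-- Commutation with the affine map `a x + (1 - a) c` fixing `c`. -/
theorem comp_eq_comp_affine_iff {a c b : F} (ha0 : a ≠ 0) (ha1 : a ≠ 1) (hr : 0 < orderOf a)
    (hb : b = c - a * c) (g : F[X]) :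
    (C a * X + C b).comp g = g.comp (C a * X + C b) ↔
      ∃ q : F[X], (X * expand F (orderOf a) q).comp (X - C c) + C c = g := by
  constructor
  · intro hg
    obtain ⟨q, hq⟩ := exists_eq_X_mul_expand_of_comp_C_mul_X ha0 ha1 hr
      (h := g.comp (X + C c) - C c) (by
        have key : (X + C c : F[X]).comp (C a * X) = (C a * X + C b).comp (X + C c) := by
          subst hb
          simp
          ring
        rw [sub_comp, comp_assoc, key, ← comp_assoc, ← hg]
        subst hb
        simp
        ring)
    refine ⟨q, ?_⟩
    rw [← hq, sub_comp, comp_X_add_C_comp_X_sub_C]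
    simp
  · rintro ⟨q, rfl⟩
    have key : (X - C c : F[X]).comp (C a * X + C b) = (C a * X).comp (X - C c) := by
      subst hb
      simp
      ring
    have hpow : (X ^ orderOf a : F[X]).comp (C a * X) = X ^ orderOf a := by
      simp [mul_pow, ← C_pow, pow_orderOf_eq_one]
    rw [add_comp (q := C c), comp_assoc _ (X - C c), key, ← comp_assoc, expand_eq_comp_X_pow,
      mul_comp (p := X) (q := q.comp _) (r := C a * X), comp_assoc q _ (C a * X), hpow]
    subst hb
    simp
    ring

theorem injective_X_mul_expand_conj {r : ℕ} (hr : 0 < r) (c : F) :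
    Function.Injective fun q : F[X] => (X * expand F r q).comp (X - C c) + C c := by
  intro q₁ q₂ h
  have h := congrArg (fun g : F[X] => g.comp (X + C c)) (add_right_cancel h)
  simp only [comp_X_sub_C_comp_X_add_C] at h
  exact expand_injective hr (mul_left_cancel₀ X_ne_zero h)

theorem degree_X_mul_expand_conj_eq_iff {r m : ℕ} (hr : 0 < r) (c : F) (q : F[X]) :
    ((X * expand F r q).comp (X - C c) + C c).degree = ((r * m + 1 : ℕ) : WithBot ℕ) ↔
      q.degree = m := by
  rw [degree_eq_iff_natDegree_eq_of_pos (Nat.succ_pos _), natDegree_add_C, natDegree_comp,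
    natDegree_X_sub_C, mul_one]
  by_cases hq : q = 0
  · simp [hq]
  · rw [natDegree_X_mul ((expand_ne_zero hr).2 hq), natDegree_expand, degree_eq_natDegree hq,
      Nat.cast_inj, add_left_inj, mul_comm, Nat.mul_right_inj hr.ne']

end Field

end Polynomial

theorem stmt_0 (p : ℕ) (hp : p.Prime) (hp3 : 3 ≤ p) (a b : ZMod p)
    (ha0 : a ≠ 0) (ha1 : a ≠ 1) (r : ℕ) (hr : r = orderOf a)
    (d : ℕ) (hd : 1 ≤ d) (hdr : d ≡ 1 [MOD r]) :
    {g : Polynomial (ZMod p) | g.degree = d ∧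
        (C a * X + C b).comp g = g.comp (C a * X + C b)}.Finite ∧
    {g : Polynomial (ZMod p) | g.degree = d ∧
        (C a * X + C b).comp g = g.comp (C a * X + C b)}.ncard
      = (p - 1) * p ^ ((d - 1) / r) := by
  have : Fact p.Prime := ⟨hp⟩
  have hr0 : 0 < r :=
    hr ▸ orderOf_pos_iff.2 (isOfFinOrder_iff_pow_eq_one.2
      ⟨p - 1, by omega, ZMod.pow_card_sub_one_eq_one ha0⟩)
  obtain ⟨m, hm⟩ := (Nat.modEq_iff_dvd' hd).1 hdr.symm
  obtain rfl : d = r * m + 1 := by omega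
  have hc : b = b / (1 - a) - a * (b / (1 - a)) := by
    have : 1 - a ≠ 0 := sub_ne_zero.2 ha1.symm
    field_simp
  have himage : {g : Polynomial (ZMod p) | g.degree = ((r * m + 1 : ℕ) : WithBot ℕ) ∧
        (C a * X + C b).comp g = g.comp (C a * X + C b)} =
      (fun q => (X * expand (ZMod p) r q).comp (X - C (b / (1 - a))) + C (b / (1 - a))) ''
        {q | q.degree = (m : WithBot ℕ)} := by
    ext g
    simp only [Set.mem_ofPred_eq, Set.mem_image,
      comp_eq_comp_affine_iff ha0 ha1 (hr ▸ hr0) hc, ← hr]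
    constructor
    · rintro ⟨hg, q, rfl⟩
      exact ⟨q, (degree_X_mul_expand_conj_eq_iff hr0 _ q).1 hg, rfl⟩
    · rintro ⟨q, hq, rfl⟩
      exact ⟨(degree_X_mul_expand_conj_eq_iff hr0 _ q).2 hq, q, rfl⟩
  obtain ⟨hfin, hcard⟩ := finite_and_ncard_degree_eq (ZMod p) m
  rw [himage]
  refine ⟨hfin.image _, ?_⟩
  rw [Set.ncard_image_of_injective _ (injective_X_mul_expand_conj hr0 _), hcard, Nat.card_zmod,
    Nat.add_sub_cancel, Nat.mul_div_cancel_left _ hr0]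
end

section
/- Let F be a finite field with q elements, let a, b ∈ F with a ≠ 0 and a ≠ 1, let f = a·x + b ∈ F[x], and let r be the multiplicative order of a in F^×. For every integer d ≥ 1: if d ≡ 1 (mod r), then the set C_d(f) = {g ∈ F[x] : deg g = d and f ∘ g = g ∘ f} is finite with exactly (q−1)·q^((d−1)/r) elements, and if d ≢ 1 (mod r), then C_d(f) is empty. -/
open Polynomial

/-- The polynomial `X * k(X ^ r)` conjugated by the translation that moves `0` to `t`. -/
noncomputable def conjTwist {F : Type*} [Field F] (t : F) (r : ℕ) (k : F[X]) : F[X] :=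
  (X * expand F r k).comp (X - C t) + C t

theorem conjTwist_injective {F : Type*} [Field F] (t : F) {r : ℕ} (hr : 0 < r) :
    Function.Injective (conjTwist t r) := by
  intro k l h
  have h1 := congrArg (fun p : F[X] => p.comp (X + C t)) (add_right_cancel h)
  simp only [comp_assoc, sub_comp, X_comp, C_comp, add_sub_cancel_right, comp_X] at h1
  exact expand_injective hr (mul_left_cancel₀ X_ne_zero h1)

theorem degree_conjTwist_eq_iff {F : Type*} [Field F] (t : F) {r d : ℕ} (hr : 0 < r)
    (hd : 1 ≤ d) (k : F[X]) : (conjTwist t r k).degree = d ↔ k ≠ 0 ∧ r * k.natDegree + 1 = d := by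
  rw [degree_eq_iff_natDegree_eq_of_pos hd, conjTwist, natDegree_add_C, natDegree_comp,
    natDegree_X_sub_C, mul_one]
  by_cases hk : k = 0
  · simp [hk]; omega
  · rw [natDegree_X_mul ((expand_ne_zero hr).2 hk), natDegree_expand, mul_comm]
    simp [hk]

theorem exists_conjTwist_of_comm {F : Type*} [Field F] {a b t : F} (ha0 : a ≠ 0) (ha1 : a ≠ 1)
    (ht : a * t + b = t) (hr : 0 < orderOf a) (g : F[X])
    (hg : (C a * X + C b).comp g = g.comp (C a * X + C b)) :
    ∃ k, conjTwist t (orderOf a) k = g := by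
  obtain ⟨h, rfl⟩ : ∃ h : F[X], g = h.comp (X - C t) + C t :=
    ⟨(g - C t).comp (X + C t), by simp [comp_assoc]⟩
  have key : C a * h = h.comp (C a * X) := by
    have h1 := congrArg (fun p : F[X] => p.comp (X + C t)) hg
    have h2 : (C a * (X + C t) + C b - C t : F[X]) = C a * X := by
      have : (C a * C t + C b : F[X]) = C t := by rw [← C_mul, ← C_add, ht]
      linear_combination this
    simp only [comp_assoc, sub_comp, X_comp, C_comp, add_sub_cancel_right, comp_X, add_comp,
      mul_comp, h2] at h1
    have : (C a * C t + C b : F[X]) = C t := by rw [← C_mul, ← C_add, ht]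
    linear_combination h1 - this
  have hc (n : ℕ) : a * h.coeff n = h.coeff n * a ^ n := by
    have := congrArg (fun p : F[X] => p.coeff n) key
    simpa [comp_C_mul_X_coeff] using this
  refine ⟨contract (orderOf a) (divX h), ?_⟩
  rw [conjTwist]
  congr 2
  ext n
  cases n with
  | zero =>
    have h0 := hc 0
    have : (a - 1) * h.coeff 0 = 0 := by linear_combination h0
    simpa [sub_ne_zero.2 ha1, eq_comm] using this
  | succ n =>
    rw [coeff_X_mul, coeff_expand hr]
    split_ifs with hn
    · rw [coeff_contract hr.ne', Nat.div_mul_cancel hn, coeff_divX]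
    · by_contra hne
      refine hn (orderOf_dvd_of_pow_eq_one ?_)
      have h1 : h.coeff (n + 1) * a * (a ^ n - 1) = 0 := by linear_combination -hc (n + 1)
      have h2 := (mul_eq_zero.1 h1).resolve_left (mul_ne_zero (Ne.symm hne) ha0)
      exact sub_eq_zero.1 h2

theorem conjTwist_comm {F : Type*} [Field F] {a b t : F} (ht : a * t + b = t) (k : F[X]) :
    (C a * X + C b).comp (conjTwist t (orderOf a) k)
      = (conjTwist t (orderOf a) k).comp (C a * X + C b) := by
  have hC : (C a * C t + C b : F[X]) = C t := by rw [← C_mul, ← C_add, ht]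
  have hX : (C a * X + C b - C t : F[X]) = C a * (X - C t) := by linear_combination hC
  have hp : (C a * (X - C t)) ^ orderOf a = (X - C t) ^ orderOf a := by
    rw [mul_pow, ← C_pow, pow_orderOf_eq_one, C_1, one_mul]
  simp only [conjTwist, add_comp, mul_comp, X_comp, C_comp, comp_assoc, sub_comp, hX,
    expand_eq_comp_X_pow, pow_comp, hp]
  linear_combination hC

theorem finite_ncard_degree_eq (F : Type*) [Field F] [Fintype F] (n : ℕ) :
    {k : F[X] | k.degree = n}.Finite ∧
      {k : F[X] | k.degree = n}.ncard = (Fintype.card F - 1) * Fintype.card F ^ n := by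
  have hfin (m : ℕ) : (degreeLT F m : Set F[X]).Finite :=
    Finite.of_equiv _ (degreeLTEquiv F m).toEquiv.symm
  have hcard (m : ℕ) : (degreeLT F m : Set F[X]).ncard = Fintype.card F ^ m := by
    rw [← Nat.card_coe_set_eq]
    refine (Nat.card_congr (degreeLTEquiv F m).toEquiv).trans ?_
    simp
  have hset : {k : F[X] | k.degree = n} = (degreeLT F (n + 1) : Set F[X]) \ degreeLT F n := by
    ext k
    simp only [Set.mem_ofPred_eq, Set.mem_sdiff, SetLike.mem_coe, mem_degreeLT, not_lt]
    by_cases hk : k = 0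
    · simp [hk]
    · rw [degree_eq_natDegree hk]
      norm_cast
      omega
  rw [hset]
  refine ⟨(hfin _).sdiff, ?_⟩
  rw [Set.ncard_sdiff (SetLike.coe_subset_coe.2 (degreeLT_mono n.le_succ)) (hfin n), hcard, hcard,
    Nat.sub_mul, one_mul, pow_succ']

theorem stmt_2 (F : Type*) [Field F] [Fintype F] (q : ℕ) (hq : Fintype.card F = q)
    (a b : F) (ha0 : a ≠ 0) (ha1 : a ≠ 1) (r : ℕ) (hr : r = orderOf a)
    (d : ℕ) (hd : 1 ≤ d) :
    (d ≡ 1 [MOD r] →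
      {g : Polynomial F | g.degree = d ∧
          (C a * X + C b).comp g = g.comp (C a * X + C b)}.Finite ∧
      {g : Polynomial F | g.degree = d ∧
          (C a * X + C b).comp g = g.comp (C a * X + C b)}.ncard
        = (q - 1) * q ^ ((d - 1) / r)) ∧
    (¬ d ≡ 1 [MOD r] →
      {g : Polynomial F | g.degree = d ∧
          (C a * X + C b).comp g = g.comp (C a * X + C b)} = ∅) := by
  subst hq
  have hpos : 0 < orderOf a := by
    rw [← Units.val_mk0 ha0, orderOf_units]
    exact orderOf_pos _
  obtain ⟨t, ht⟩ : ∃ t, a * t + b = t := by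
    have : 1 - a ≠ 0 := sub_ne_zero.2 ha1.symm
    exact ⟨b / (1 - a), by field_simp; ring⟩
  have himage : {g : F[X] | g.degree = d ∧
      (C a * X + C b).comp g = g.comp (C a * X + C b)} =
      conjTwist t r '' {k | k ≠ 0 ∧ r * k.natDegree + 1 = d} := by
    subst hr
    ext g
    constructor
    · rintro ⟨hgd, hg⟩
      obtain ⟨k, rfl⟩ := exists_conjTwist_of_comm ha0 ha1 ht hpos g hg
      exact ⟨k, (degree_conjTwist_eq_iff t hpos hd k).1 hgd, rfl⟩
    · rintro ⟨k, hk, rfl⟩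
      exact ⟨(degree_conjTwist_eq_iff t hpos hd k).2 hk, conjTwist_comm ht k⟩
  rw [← hr] at hpos
  rw [himage]
  constructor
  · intro hmod
    obtain ⟨n, hn⟩ := (Nat.modEq_iff_dvd' hd).1 hmod.symm
    have hset : {k : F[X] | k ≠ 0 ∧ r * k.natDegree + 1 = d} = {k : F[X] | k.degree = n} := by
      ext k
      obtain rfl : d = r * n + 1 := by omega
      simp only [Set.mem_ofPred_eq, Nat.add_right_cancel_iff, Nat.mul_right_inj hpos.ne']
      constructor
      · rintro ⟨hk, rfl⟩
        exact degree_eq_natDegree hk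
      · intro hk
        exact ⟨by rintro rfl; simp at hk, natDegree_eq_of_degree_eq_some hk⟩
    rw [hset, hn, Nat.mul_div_cancel_left n hpos,
      Set.ncard_image_of_injective _ (conjTwist_injective t hpos)]
    exact ⟨(finite_ncard_degree_eq F n).1.image _, (finite_ncard_degree_eq F n).2⟩
  · intro hmod
    rw [Set.image_eq_empty, Set.eq_empty_iff_forall_notMem]
    rintro k ⟨-, rfl⟩
    exact hmod (by simp [Nat.ModEq])
end

section
/- Let p ≥ 3 be a prime, let b ∈ F_p with b ≠ 0, and let f = x + b ∈ F_p[x]. Let k be an integer with 1 ≤ k ≤ p and set d = k·p. Then the set C_d(f) = {g ∈ F_p[x] : deg g = d and f ∘ g = g ∘ f} is finite and has exactly (p−1)·p^k elements. -/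
open Polynomial

namespace ZMod

variable {p : ℕ} [Fact p.Prime]

/-- The Artin–Schreier polynomial `X ^ p - X` over `ZMod p`. -/
noncomputable def artinSchreier (p : ℕ) : (ZMod p)[X] := X ^ p - X

theorem artinSchreier_natDegree : (artinSchreier p).natDegree = p :=
  FiniteField.X_pow_card_sub_X_natDegree_eq _ (Fact.out : p.Prime).one_lt

theorem artinSchreier_monic : (artinSchreier p).Monic := by
  apply monic_X_pow_sub
  rw [degree_X]
  exact_mod_cast (Fact.out : p.Prime).one_lt

theorem eval_artinSchreier (a : ZMod p) : (artinSchreier p).eval a = 0 := by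
  simp [artinSchreier]

theorem artinSchreier_comp_X_add_C (b : ZMod p) :
    (artinSchreier p).comp (X + C b) = artinSchreier p := by
  simp only [artinSchreier, sub_comp, pow_comp, X_comp, add_pow_char, ← C_pow, ZMod.pow_card]
  ring

theorem artinSchreier_dvd_of_eval_eq_zero {h : (ZMod p)[X]} (H : ∀ a, h.eval a = 0) :
    artinSchreier p ∣ h := by
  rw [← modByMonic_eq_zero_iff_dvd artinSchreier_monic]
  refine eq_zero_of_natDegree_lt_card_of_eval_eq_zero _ (f := (id : ZMod p → ZMod p))
    Function.injective_id (fun a => ?_) ?_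
  · have := congrArg (eval a) (modByMonic_add_div h (artinSchreier p))
    simpa [eval_artinSchreier, H] using this
  · rw [ZMod.card]
    conv_rhs => rw [← artinSchreier_natDegree (p := p)]
    refine natDegree_modByMonic_lt _ artinSchreier_monic fun h1 => ?_
    have := artinSchreier_natDegree (p := p)
    rw [h1, natDegree_one] at this
    exact (Fact.out : p.Prime).ne_zero this.symm

theorem eval_eq_eval_zero_of_comp_X_add_C {b : ZMod p} (hb : b ≠ 0) {h : (ZMod p)[X]}
    (H : h.comp (X + C b) = h) (a : ZMod p) : h.eval a = h.eval 0 := by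
  have step (x : ZMod p) : h.eval (x + b) = h.eval x := by
    simpa using congrArg (eval x) H
  have multiple (n : ℕ) : h.eval (n * b) = h.eval 0 := by
    induction n with
    | zero => simp
    | succ n ih => rw [Nat.cast_succ, add_mul, one_mul, step, ih]
  have := multiple (a / b).val
  rwa [ZMod.natCast_zmod_val, div_mul_cancel₀ _ hb] at this

theorem exists_comp_artinSchreier_eq {b : ZMod p} (hb : b ≠ 0) (h : (ZMod p)[X])
    (H : h.comp (X + C b) = h) : ∃ q : (ZMod p)[X], q.comp (artinSchreier p) = h := by
  induction hn : h.natDegree using Nat.strong_induction_on generalizing h with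
  | _ n ih =>
    obtain ⟨r, hr⟩ : artinSchreier p ∣ h - C (h.eval 0) :=
      artinSchreier_dvd_of_eval_eq_zero fun a => by
        simp [eval_eq_eval_zero_of_comp_X_add_C hb H a]
    have h_eq : h = artinSchreier p * r + C (h.eval 0) := by rw [← hr]; ring
    by_cases hr0 : r = 0
    · exact ⟨C (h.eval 0), by rw [C_comp, h_eq, hr0]; simp⟩
    have invariant : r.comp (X + C b) = r := by
      apply mul_left_cancel₀ (artinSchreier_monic (p := p)).ne_zero
      rw [← hr]
      conv_lhs => rw [← artinSchreier_comp_X_add_C b]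
      rw [← mul_comp, ← hr, sub_comp, H, C_comp]
    have degree_lt : r.natDegree < n := by
      rw [← hn, ← natDegree_sub_C (p := h) (a := h.eval 0), hr,
        natDegree_mul artinSchreier_monic.ne_zero hr0, artinSchreier_natDegree]
      have := (Fact.out : p.Prime).pos
      omega
    obtain ⟨q, hq⟩ := ih _ degree_lt r invariant rfl
    refine ⟨X * q + C (h.eval 0), ?_⟩
    rw [add_comp, mul_comp, X_comp, hq, C_comp, ← h_eq]

theorem degree_X_add_comp_artinSchreier_eq_iff {k : ℕ} (hk : 1 ≤ k) (q : (ZMod p)[X]) :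
    (X + q.comp (artinSchreier p)).degree = ((k * p : ℕ) : WithBot ℕ) ↔ q.degree = k := by
  have hp := (Fact.out : p.Prime)
  have hkp : 1 < k * p := lt_of_lt_of_le hp.one_lt (Nat.le_mul_of_pos_left _ hk)
  have comp_degree : (q.comp (artinSchreier p)).natDegree = q.natDegree * p := by
    rw [natDegree_comp, artinSchreier_natDegree]
  rw [degree_eq_iff_natDegree_eq_of_pos (by omega), degree_eq_iff_natDegree_eq_of_pos (by omega)]
  rcases Nat.eq_zero_or_pos q.natDegree with h0 | h0
  · have : (X + q.comp (artinSchreier p)).natDegree ≤ 1 :=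
      natDegree_add_le_of_degree_le natDegree_X_le (by rw [comp_degree, h0]; omega)
    omega
  · have : 1 < q.natDegree * p := lt_of_lt_of_le hp.one_lt (Nat.le_mul_of_pos_left _ h0)
    rw [natDegree_add_eq_right_of_natDegree_lt (by rwa [natDegree_X, comp_degree]), comp_degree]
    exact Nat.mul_left_inj hp.ne_zero

theorem setOf_commute_X_add_C_eq_image {b : ZMod p} (hb : b ≠ 0) {k : ℕ} (hk : 1 ≤ k) :
    {g : (ZMod p)[X] | g.degree = (k * p : ℕ) ∧ (X + C b).comp g = g.comp (X + C b)} =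
      (fun q => X + q.comp (artinSchreier p)) '' {q : (ZMod p)[X] | q.degree = k} := by
  ext g
  simp only [Set.mem_ofPred_eq, Set.mem_image, add_comp, X_comp, C_comp]
  constructor
  · rintro ⟨hdeg, hcomm⟩
    obtain ⟨q, hq⟩ := exists_comp_artinSchreier_eq hb (g - X) (by
      rw [sub_comp, X_comp, ← hcomm]; ring)
    have hg : X + q.comp (artinSchreier p) = g := by rw [hq]; ring
    exact ⟨q, (degree_X_add_comp_artinSchreier_eq_iff hk q).1 (hg ▸ hdeg), hg⟩
  · rintro ⟨q, hq, rfl⟩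
    refine ⟨(degree_X_add_comp_artinSchreier_eq_iff hk q).2 hq, ?_⟩
    rw [add_comp, X_comp, comp_assoc, artinSchreier_comp_X_add_C]
    ring

theorem X_add_comp_artinSchreier_injective :
    Function.Injective fun q : (ZMod p)[X] => X + q.comp (artinSchreier p) := by
  intro q₁ q₂ h
  have h_zero : (q₁ - q₂).comp (artinSchreier p) = 0 := by
    rw [sub_comp, sub_eq_zero]
    exact add_left_cancel h
  rcases comp_eq_zero_iff.1 h_zero with h0 | ⟨-, h0⟩
  · exact sub_eq_zero.1 h0
  · have := artinSchreier_natDegree (p := p)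
    rw [h0, natDegree_C] at this
    exact absurd this.symm (Fact.out : p.Prime).ne_zero

end ZMod

namespace Polynomial

theorem setOf_degree_eq_diff {F : Type*} [Field F] (k : ℕ) :
    {q : F[X] | q.degree = k} = (degreeLT F (k + 1) : Set F[X]) \ degreeLT F k := by
  ext q
  simp only [Set.mem_ofPred_eq, Set.mem_sdiff, SetLike.mem_coe, mem_degreeLT, not_lt,
    Nat.cast_add, Nat.cast_one]
  rw [← Nat.cast_one, ← Nat.cast_add]
  rcases eq_or_ne q 0 with rfl | hq
  · simp
  · rw [degree_eq_natDegree hq]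
    norm_cast
    omega

variable {F : Type*} [Field F] [Fintype F]

theorem finite_degreeLT (n : ℕ) : (degreeLT F n : Set F[X]).Finite :=
  have : Finite (degreeLT F n) := Finite.of_equiv _ (degreeLTEquiv F n).symm.toEquiv
  Set.toFinite _

theorem ncard_degreeLT (n : ℕ) : (degreeLT F n : Set F[X]).ncard = Fintype.card F ^ n := by
  rw [← Nat.card_coe_set_eq]
  refine (Nat.card_congr (degreeLTEquiv F n).toEquiv).trans ?_
  simp

theorem ncard_setOf_degree_eq (k : ℕ) :
    {q : F[X] | q.degree = k}.ncard = (Fintype.card F - 1) * Fintype.card F ^ k := by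
  rw [setOf_degree_eq_diff,
    Set.ncard_sdiff (SetLike.coe_subset_coe.2 (degreeLT_mono k.le_succ)) (finite_degreeLT k),
    ncard_degreeLT, ncard_degreeLT, pow_succ', Nat.sub_mul, one_mul]

end Polynomial

theorem stmt_4 (p : ℕ) (hp : p.Prime) (hp3 : 3 ≤ p) (b : ZMod p) (hb : b ≠ 0)
    (k : ℕ) (hk1 : 1 ≤ k) (hkp : k ≤ p) :
    {g : Polynomial (ZMod p) | g.degree = (k * p : ℕ) ∧
        (X + C b).comp g = g.comp (X + C b)}.Finite ∧
    {g : Polynomial (ZMod p) | g.degree = (k * p : ℕ) ∧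
        (X + C b).comp g = g.comp (X + C b)}.ncard = (p - 1) * p ^ k := by
  have : Fact p.Prime := ⟨hp⟩
  rw [ZMod.setOf_commute_X_add_C_eq_image hb hk1]
  constructor
  · rw [setOf_degree_eq_diff]
    exact (finite_degreeLT (k + 1)).sdiff.image _
  · rw [Set.ncard_image_of_injective _ ZMod.X_add_comp_artinSchreier_injective,
      ncard_setOf_degree_eq, ZMod.card]
end

section
/- Let p ≥ 3 be a prime, let b ∈ F_p with b ≠ 0, and let f = x + b ∈ F_p[x]. If g ∈ F_p[x] has degree exactly d with d ≥ 2 and f ∘ g = g ∘ f, then p divides d. -/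
open Polynomial

/-- The subleading coefficient of a translated polynomial. -/
theorem Polynomial.taylor_coeff_of_natDegree_le_succ {R : Type*} [CommRing R] (r : R) {f : R[X]}
    {n : ℕ} (hf : f.natDegree ≤ n + 1) :
    (taylor r f).coeff n = (n + 1) * f.coeff (n + 1) * r + f.coeff n := by
  have h : (hasseDeriv n f).natDegree ≤ 1 :=
    (natDegree_hasseDeriv_le f n).trans (by lia)
  rw [taylor_coeff, eq_X_add_C_of_natDegree_le_one h]
  simp [hasseDeriv_coeff, add_comm 1 n]

theorem stmt_5 (p : ℕ) (hp : p.Prime) (hp3 : 3 ≤ p) (b : ZMod p) (hb : b ≠ 0)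
    (g : Polynomial (ZMod p)) (d : ℕ) (hd : 2 ≤ d) (hdeg : g.degree = d)
    (hcomm : (X + C b).comp g = g.comp (X + C b)) :
    p ∣ d := by
  have : Fact p.Prime := ⟨hp⟩
  obtain ⟨n, rfl⟩ : ∃ n, d = n + 1 := ⟨d - 1, by lia⟩
  have hnat : g.natDegree = n + 1 := natDegree_eq_of_degree_eq_some hdeg
  have hlead : g.coeff (n + 1) ≠ 0 := coeff_ne_zero_of_eq_degree hdeg
  have hn : n ≠ 0 := by lia
  have hcoeff := congrArg (fun q => q.coeff n) hcomm
  simp only [← taylor_apply, taylor_coeff_of_natDegree_le_succ b hnat.le, add_comp, X_comp,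
    C_comp, coeff_add, coeff_C_of_ne_zero hn, add_zero, right_eq_add, mul_eq_zero, hb, hlead,
    or_false] at hcoeff
  rw [← ZMod.natCast_eq_zero_iff]
  exact_mod_cast hcoeff
end

section
/- Let p be an odd prime, let k be an integer with 1 ≤ k ≤ p, and let g ∈ F_p[x] have degree exactly k·p and satisfy (x+1) ∘ g = g ∘ (x+1) (equivalently g(x+1) = g(x) + 1). Then for every J ∈ S_k, the coefficient of x^J in g is zero; that is, every index with nonzero coefficient in g lies in R_k. -/
open Polynomial

/-- The set `T_k` from the paper: `T_0 = {0}`, `T_p = {p²}`, and for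
`0 < k < p`, `T_k = { i·p + j : i + j = k }`. -/
def Tset (p k : ℕ) : Set ℕ :=
  if k = 0 then {0}
  else if k = p then {p ^ 2}
  else {n | ∃ i j : ℕ, i + j = k ∧ n = i * p + j}

/-- `R_k = T_0 ∪ T_1 ∪ ⋯ ∪ T_k`. -/
def Rset (p k : ℕ) : Set ℕ := ⋃ i ∈ Finset.range (k + 1), Tset p i

/-- `S_k = {0, 1, …, k·p} \ R_k`. -/
def Sset (p k : ℕ) : Set ℕ := {n | n ≤ k * p} \ Rset p k

/-- A translation-invariant polynomial over `ZMod p` takes a single value on `ZMod p`. -/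
theorem eval_eq_eval_zero_of_comp_X_add_one {p : ℕ} [Fact p.Prime] {h : (ZMod p)[X]}
    (hh : h.comp (X + 1) = h) (a : ZMod p) : h.eval a = h.eval 0 := by
  have step (b : ZMod p) : h.eval (b + 1) = h.eval b := by
    conv_rhs => rw [← hh]
    simp [eval_comp]
  have key (n : ℕ) : h.eval (n : ZMod p) = h.eval 0 := by
    induction n with
    | zero => simp
    | succ n ih => rw [Nat.cast_succ, step, ih]
  simpa using key a.val

theorem X_pow_sub_X_dvd_of_forall_eval_eq_zero {p : ℕ} [Fact p.Prime] {h : (ZMod p)[X]}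
    (hh : ∀ a, h.eval a = 0) : X ^ p - X ∣ h := by
  have hp : 1 < p := (Fact.out : p.Prime).one_lt
  have hdeg : (X ^ p - X : (ZMod p)[X]).natDegree = p :=
    FiniteField.X_pow_card_sub_X_natDegree_eq _ hp
  have hmonic : (X ^ p - X : (ZMod p)[X]).Monic :=
    monic_X_pow_sub (by rw [degree_X]; exact_mod_cast hp)
  rw [← modByMonic_eq_zero_iff_dvd hmonic]
  refine eq_zero_of_natDegree_lt_card_of_eval_eq_zero _ Function.injective_id (fun a => ?_) ?_
  · have := congrArg (eval a) (modByMonic_add_div h (X ^ p - X))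
    simpa [hh a, ZMod.pow_card] using this
  · rw [ZMod.card]
    conv_rhs => rw [← hdeg]
    exact natDegree_modByMonic_lt _ hmonic (fun h1 => by simp [h1] at hdeg; omega)

/-- The polynomials over `ZMod p` invariant under `X ↦ X + 1` are the polynomials in `X ^ p - X`. -/
theorem exists_eq_comp_X_pow_sub_X {p : ℕ} [Fact p.Prime] (h : (ZMod p)[X])
    (hh : h.comp (X + 1) = h) : ∃ f : (ZMod p)[X], h = f.comp (X ^ p - X) := by
  have hp : 1 < p := (Fact.out : p.Prime).one_lt
  have hdeg : (X ^ p - X : (ZMod p)[X]).natDegree = p :=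
    FiniteField.X_pow_card_sub_X_natDegree_eq _ hp
  have hne : (X ^ p - X : (ZMod p)[X]) ≠ 0 := FiniteField.X_pow_card_sub_X_ne_zero _ hp
  induction hn : h.natDegree using Nat.strong_induction_on generalizing h with
  | _ n ih =>
    obtain ⟨d, hd⟩ : X ^ p - X ∣ h - C (h.eval 0) :=
      X_pow_sub_X_dvd_of_forall_eval_eq_zero fun a => by
        simp [eval_eq_eval_zero_of_comp_X_add_one hh a]
    by_cases hd0 : d = 0
    · exact ⟨C (h.eval 0), by simpa [hd0, sub_eq_zero] using hd⟩
    have hinv : d.comp (X + 1) = d := by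
      have := congrArg (fun f => f.comp (X + 1)) hd
      simp only [sub_comp, mul_comp, hh, C_comp, pow_comp, X_comp, add_pow_char, one_pow,
        add_sub_add_right_eq_sub] at this
      exact mul_left_cancel₀ hne (this.symm.trans hd)
    have hlt : d.natDegree < n := by
      have := congrArg natDegree hd
      rw [natDegree_sub_C, natDegree_mul hne hd0, hdeg] at this
      omega
    obtain ⟨f, hf⟩ := ih _ hlt d hinv rfl
    refine ⟨X * f + C (h.eval 0), ?_⟩
    rw [add_comp, mul_comp, X_comp, C_comp, ← hf, ← hd, sub_add_cancel]

theorem exists_eq_mul_add_of_coeff_X_pow_sub_X_pow_ne_zero {R : Type*} [CommRing R] {p m J : ℕ}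
    (hJ : ((X ^ p - X : R[X]) ^ m).coeff J ≠ 0) : ∃ i j : ℕ, i + j = m ∧ J = i * p + j := by
  rw [sub_eq_add_neg, (Commute.all _ _).add_pow', finsetSum_coeff] at hJ
  obtain ⟨⟨i, j⟩, hij, hne⟩ := Finset.exists_ne_zero_of_sum_ne_zero hJ
  refine ⟨i, j, Finset.HasAntidiagonal.mem_antidiagonal.1 hij, ?_⟩
  by_contra hJ'
  apply hne
  have : (X ^ p : R[X]) ^ i * (-X) ^ j = C ((-1) ^ j) * X ^ (i * p + j) := by
    rw [neg_pow, ← pow_mul, pow_add, mul_comm p i]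
    simp only [map_pow, map_neg, map_one]
    ring
  rw [coeff_smul, this, coeff_C_mul_X_pow, if_neg hJ', smul_zero]

theorem mem_Rset_of_mem_Tset {p k m J : ℕ} (hm : m ≤ k) (hJ : J ∈ Tset p m) : J ∈ Rset p k :=
  Set.mem_biUnion (Finset.mem_coe.2 (Finset.mem_range.2 (Nat.lt_succ_of_le hm))) hJ

theorem mem_Rset_of_coeff_X_pow_sub_X_pow_ne_zero {p k m J : ℕ} [Fact p.Prime]
    (hm : m ≤ k) (hk : k ≤ p) (hJ : ((X ^ p - X : (ZMod p)[X]) ^ m).coeff J ≠ 0) :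
    J ∈ Rset p k := by
  have hp : 1 < p := (Fact.out : p.Prime).one_lt
  rcases (hm.trans hk).eq_or_lt with rfl | hmp
  · rw [sub_pow_char, ← pow_mul, coeff_sub, coeff_X_pow, coeff_X_pow] at hJ
    by_cases h1 : J = m * m
    · exact mem_Rset_of_mem_Tset hm (by rw [Tset, if_neg (by omega), if_pos rfl, h1, sq]; rfl)
    by_cases h2 : J = m
    · refine mem_Rset_of_mem_Tset (m := 1) (by omega) ?_
      rw [Tset, if_neg one_ne_zero, if_neg hp.ne]
      exact ⟨1, 0, rfl, by omega⟩
    · simp [h1, h2] at hJ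
  · refine mem_Rset_of_mem_Tset hm ?_
    obtain ⟨i, j, hij, rfl⟩ := exists_eq_mul_add_of_coeff_X_pow_sub_X_pow_ne_zero hJ
    rw [Tset]
    split_ifs with h0 h1
    · obtain ⟨rfl, rfl⟩ : i = 0 ∧ j = 0 := by omega
      simp
    · omega
    · exact ⟨i, j, hij, rfl⟩

theorem stmt_13 (p : ℕ) (hp : p.Prime) (hodd : Odd p) (k : ℕ) (hk1 : 1 ≤ k) (hkp : k ≤ p)
    (g : Polynomial (ZMod p)) (hdeg : g.degree = (k * p : ℕ))
    (hcomm : (X + 1).comp g = g.comp (X + 1)) :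
    ∀ J ∈ Sset p k, g.coeff J = 0 := by
  have : Fact p.Prime := ⟨hp⟩
  rintro J ⟨-, hJ⟩
  have hinv : (g - X).comp (X + 1) = g - X := by
    rw [sub_comp, ← hcomm]
    simp
  obtain ⟨f, hf⟩ := exists_eq_comp_X_pow_sub_X (g - X) hinv
  have hfdeg : f.natDegree ≤ k := by
    have h1 : (g - X).natDegree ≤ k * p :=
      (natDegree_sub_le _ _).trans (max_le (natDegree_le_of_degree_le hdeg.le)
        (natDegree_X_le.trans (Nat.mul_pos hk1 hp.pos)))
    rw [hf, natDegree_comp, FiniteField.X_pow_card_sub_X_natDegree_eq _ hp.one_lt] at h1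
    exact Nat.le_of_mul_le_mul_right h1 hp.pos
  have hJ1 : J ≠ 1 := by
    rintro rfl
    refine hJ (mem_Rset_of_mem_Tset hk1 ?_)
    rw [Tset, if_neg one_ne_zero, if_neg hp.one_lt.ne]
    exact ⟨0, 1, rfl, by simp⟩
  rw [eq_add_of_sub_eq hf, coeff_add, coeff_X_of_ne_one hJ1, add_zero, comp, eval₂_eq_sum_range,
    finsetSum_coeff]
  refine Finset.sum_eq_zero fun m hm => ?_
  rw [coeff_C_mul]
  by_contra hne
  exact hJ (mem_Rset_of_coeff_X_pow_sub_X_pow_ne_zero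
    ((Nat.lt_succ_iff.1 (Finset.mem_range.1 hm)).trans hfdeg) hkp (right_ne_zero_of_mul hne))
end

section
/- Let p ≥ 3 be a prime, let k be an integer with 1 ≤ k ≤ p, and let a ∈ F_p with a ≠ 0. Then there exists a polynomial g ∈ F_p[x] of degree exactly k·p with leading coefficient a such that (x+1) ∘ g = g ∘ (x+1), i.e., g(x+1) = g(x) + 1. -/
open Polynomial

theorem stmt_14 (p : ℕ) (hp : p.Prime) (hp3 : 3 ≤ p) (k : ℕ) (hk1 : 1 ≤ k) (hkp : k ≤ p)
    (a : ZMod p) (ha : a ≠ 0) :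
    ∃ g : Polynomial (ZMod p), g.degree = (k * p : ℕ) ∧ g.leadingCoeff = a ∧
      (X + 1).comp g = g.comp (X + 1) := by
  have : Fact p.Prime := ⟨hp⟩
  have hX : (X : (ZMod p)[X]).degree < (p : ℕ) := by
    rw [degree_X]
    exact_mod_cast hp.one_lt
  have hmonic : (X ^ p - X : (ZMod p)[X]).Monic := monic_X_pow_sub hX
  have hdeg : (X ^ p - X : (ZMod p)[X]).degree = (p : ℕ) := by
    rw [degree_sub_eq_left_of_degree_lt (by rwa [degree_X_pow]), degree_X_pow]
  have hdeg' : (C a * (X ^ p - X) ^ k : (ZMod p)[X]).degree = (k * p : ℕ) := by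
    rw [degree_C_mul ha, degree_pow, hdeg, nsmul_eq_mul]
    norm_cast
  have hlt : (X : (ZMod p)[X]).degree < (C a * (X ^ p - X) ^ k : (ZMod p)[X]).degree := by
    rw [hdeg', degree_X]
    exact_mod_cast (by nlinarith : 1 < k * p)
  refine ⟨C a * (X ^ p - X) ^ k + X, ?_, ?_, ?_⟩
  · rw [degree_add_eq_left_of_degree_lt hlt, hdeg']
  · rw [leadingCoeff_add_of_degree_lt' hlt, leadingCoeff_mul, (hmonic.pow k).leadingCoeff,
      leadingCoeff_C, mul_one]
  · have hshift : ((X + 1) ^ p - (X + 1) : (ZMod p)[X]) = X ^ p - X := by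
      rw [add_pow_char, one_pow]
      ring
    simp only [add_comp, mul_comp, pow_comp, sub_comp, C_comp, X_comp, one_comp, hshift]
    ring
end

section
/- Let p ≥ 3 be a prime and let g ∈ F_p[x] have degree exactly p. Then (x+1) ∘ g = g ∘ (x+1) if and only if there exist a ∈ F_p with a ≠ 0 and c ∈ F_p such that g = a·x^p + (1 − a)·x + c. -/
open Polynomial

/-- A polynomial over `ZMod p` of degree less than `p` that is invariant under translation by `1`
is constant. -/
theorem eq_C_of_comp_X_add_one_eq {p : ℕ} [Fact p.Prime] {h : (ZMod p)[X]}
    (hdeg : h.degree < p) (hcomp : h.comp (X + 1) = h) : h = C (h.eval 0) := by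
  have hstep (x : ZMod p) : h.eval (x + 1) = h.eval x := by
    simpa using congrArg (eval x) hcomp
  have hnat (n : ℕ) : h.eval (n : ZMod p) = h.eval 0 := by
    induction n with
    | zero => simp
    | succ n ih => rw [Nat.cast_succ, hstep, ih]
  have hcard : (Finset.univ : Finset (ZMod p)).card = p := by simp [ZMod.card]
  refine eq_of_degrees_lt_of_eval_finset_eq Finset.univ (by rwa [hcard]) ?_ fun x _ => ?_
  · rw [hcard]
    exact degree_C_le.trans_lt (by exact_mod_cast (Fact.out : p.Prime).pos)
  · rw [eval_C, ← ZMod.natCast_zmod_val x, hnat]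

theorem stmt_15 (p : ℕ) (hp : p.Prime) (hp3 : 3 ≤ p)
    (g : Polynomial (ZMod p)) (hdeg : g.degree = (p : ℕ)) :
    (X + 1).comp g = g.comp (X + 1) ↔
      ∃ a c : ZMod p, a ≠ 0 ∧ g = C a * X ^ p + C (1 - a) * X + C c := by
  have : Fact p.Prime := ⟨hp⟩
  have hfrob : ((X : (ZMod p)[X]) + 1) ^ p = X ^ p + 1 := by
    rw [add_pow_char, one_pow]
  constructor
  · intro hcomm
    have hcoeff : g.coeff p ≠ 0 := coeff_ne_zero_of_eq_degree hdeg
    set a := g.coeff p with ha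
    set h := g - (C a * X ^ p + C (1 - a) * X) with hh
    have hlt : h.degree < p := by
      rw [degree_lt_iff_coeff_zero]
      intro m hm
      have hm1 : 1 ≠ m := by omega
      rcases hm.eq_or_lt with rfl | hm
      · simp [hh, ← ha, coeff_X, hm1, -map_sub]
      · have hg : g.coeff m = 0 :=
          coeff_eq_zero_of_degree_lt (by rw [hdeg]; exact_mod_cast hm)
        simp [hh, hg, coeff_X, hm1, coeff_X_pow, hm.ne', -map_sub]
    have hinv : h.comp (X + 1) = h := by
      simp only [add_comp, X_comp, one_comp] at hcomm
      simp only [hh, sub_comp, add_comp, mul_comp, C_comp, pow_comp, X_comp, one_comp, hfrob,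
        ← hcomm, C_sub, C_1]
      ring
    refine ⟨a, h.eval 0, hcoeff, ?_⟩
    rw [← eq_C_of_comp_X_add_one_eq hlt hinv, hh]
    ring
  · rintro ⟨a, c, -, rfl⟩
    simp only [add_comp, mul_comp, C_comp, pow_comp, X_comp, one_comp, sub_comp, hfrob, C_sub, C_1]
    ring
end

section
/- Let p ≥ 3 be a prime and let g ∈ F_p[x] have degree exactly 2p. Then (x+1) ∘ g = g ∘ (x+1) if and only if there exist a ∈ F_p with a ≠ 0 and b, c ∈ F_p such that g = a·x^{2p} − 2a·x^{p+1} + a·x² + b·x^p + (1 − b)·x + c. -/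
open Polynomial

/-- A polynomial over `ZMod p` invariant under translation by `1` takes a single value on
`ZMod p`. -/
theorem eval_eq_eval_zero_of_comp_X_add_one_eq {p : ℕ} [Fact p.Prime] {f : (ZMod p)[X]}
    (hf : f.comp (X + 1) = f) (x : ZMod p) : f.eval x = f.eval 0 := by
  obtain ⟨n, rfl⟩ := ZMod.natCast_zmod_surjective x
  induction n with
  | zero => simp
  | succ n ih =>
    rw [← ih]
    conv_rhs => rw [← hf]
    simp

theorem X_pow_sub_X_comp_X_add_one {p : ℕ} [Fact p.Prime] :
    (X ^ p - X : (ZMod p)[X]).comp (X + 1) = X ^ p - X := by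
  simp [add_pow_char]

/-- A polynomial over `ZMod p` invariant under translation by `1` is, up to a constant, the
product of `X ^ p - X` and another invariant polynomial. -/
theorem exists_eq_C_add_mul_of_comp_X_add_one_eq {p : ℕ} [Fact p.Prime] {f : (ZMod p)[X]}
    (hf : f.comp (X + 1) = f) :
    ∃ (c : ZMod p) (q : (ZMod p)[X]), f = C c + (X ^ p - X) * q ∧ q.comp (X + 1) = q := by
  have hdvd : (X ^ p - X : (ZMod p)[X]) ∣ f - C (f.eval 0) := by
    have h : ∏ a : ZMod p, (X - C a) = X ^ p - X := by
      have hroots := FiniteField.roots_X_pow_card_sub_X (ZMod p)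
      rw [ZMod.card] at hroots
      have hmonic : (X ^ p - X : (ZMod p)[X]).Monic :=
        monic_X_pow_sub (by simpa using (Fact.out : p.Prime).one_lt)
      rw [← prod_multiset_X_sub_C_of_monic_of_roots_card_eq hmonic, hroots]
      · rfl
      · rw [hroots, FiniteField.X_pow_card_sub_X_natDegree_eq _ (Fact.out : p.Prime).one_lt]
        simp
    rw [← h]
    refine Finset.prod_dvd_of_coprime
      (fun a _ b _ hab => pairwise_coprime_X_sub_C Function.injective_id hab) fun a _ => ?_
    simp [dvd_iff_isRoot, eval_eq_eval_zero_of_comp_X_add_one_eq hf a]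
  obtain ⟨q, hq⟩ := hdvd
  have hfq : f = C (f.eval 0) + (X ^ p - X) * q := by rw [← hq]; ring
  refine ⟨_, q, hfq, ?_⟩
  have hT : (X ^ p - X : (ZMod p)[X]) ≠ 0 :=
    FiniteField.X_pow_card_sub_X_ne_zero _ (Fact.out : p.Prime).one_lt
  rw [hfq, add_comp, mul_comp, X_pow_sub_X_comp_X_add_one, C_comp] at hf
  exact mul_left_cancel₀ hT (add_left_cancel hf)

theorem stmt_16 (p : ℕ) (hp : p.Prime) (hp3 : 3 ≤ p)
    (g : Polynomial (ZMod p)) (hdeg : g.degree = (2 * p : ℕ)) :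
    (X + 1).comp g = g.comp (X + 1) ↔
      ∃ a b c : ZMod p, a ≠ 0 ∧
        g = C a * X ^ (2 * p) - C (2 * a) * X ^ (p + 1) + C a * X ^ 2
            + C b * X ^ p + C (1 - b) * X + C c := by
  have : Fact p.Prime := ⟨hp⟩
  have hrw : ∀ a b c : ZMod p, C a * X ^ (2 * p) - C (2 * a) * X ^ (p + 1) + C a * X ^ 2
      + C b * X ^ p + C (1 - b) * X + C c
      = X + (C c + (X ^ p - X) * (C b + (X ^ p - X) * C a)) := by
    intro a b c
    simp only [C_sub, C_mul, C_1, show (C 2 : (ZMod p)[X]) = 2 from rfl]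
    ring
  constructor
  · intro h
    have hinv : (g - X).comp (X + 1) = g - X := by
      rw [sub_comp, ← h]
      simp
    obtain ⟨c, q, hq, hqinv⟩ := exists_eq_C_add_mul_of_comp_X_add_one_eq hinv
    obtain ⟨b, r, rfl, -⟩ := exists_eq_C_add_mul_of_comp_X_add_one_eq hqinv
    have hg : g = X + (C c + (X ^ p - X) * (C b + (X ^ p - X) * r)) := by rw [← hq]; ring
    have hT : (X ^ p - X : (ZMod p)[X]).natDegree = p :=
      FiniteField.X_pow_card_sub_X_natDegree_eq _ hp.one_lt
    have hT0 : (X ^ p - X : (ZMod p)[X]) ≠ 0 :=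
      FiniteField.X_pow_card_sub_X_ne_zero _ hp.one_lt
    have hnat : g.natDegree = 2 * p := natDegree_eq_of_degree_eq_some hdeg
    have hlow : (X + (C c + (X ^ p - X) * C b) : (ZMod p)[X]).natDegree ≤ p := by
      refine natDegree_add_le_of_degree_le (by simpa using hp.one_lt.le)
        (natDegree_add_le_of_degree_le (by simp) ?_)
      exact (natDegree_mul_C_le _ _).trans hT.le
    have hsplit : (X ^ p - X) * ((X ^ p - X) * r) = g - (X + (C c + (X ^ p - X) * C b)) := by
      rw [hg]; ring
    have hdegr : ((X ^ p - X) * ((X ^ p - X) * r)).natDegree = 2 * p := by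
      rw [hsplit, natDegree_sub_eq_left_of_natDegree_lt (by omega), hnat]
    have hr0 : r ≠ 0 := by
      rintro rfl
      simp at hdegr
      omega
    rw [natDegree_mul hT0 (mul_ne_zero hT0 hr0), natDegree_mul hT0 hr0, hT] at hdegr
    obtain ⟨a, rfl⟩ := natDegree_eq_zero.mp (show r.natDegree = 0 by omega)
    exact ⟨a, b, c, by simpa using hr0, by rw [hrw, hg]⟩
  · rintro ⟨a, b, c, -, rfl⟩
    rw [hrw]
    simp only [add_comp, mul_comp, C_comp, X_pow_sub_X_comp_X_add_one, X_comp, one_comp]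
    ring
end

section
/- Let p ≥ 3 be a prime and let k be an integer with 1 ≤ k ≤ p−1. Suppose g ∈ F_p[x] has the form g = x + Σ_{j=0}^{k} c_j · x^{(k−j)p + j} for some coefficients c_0, …, c_k ∈ F_p, and suppose (x+1) ∘ g = g ∘ (x+1), i.e., g(x+1) = g(x) + 1. Then for every integer j with 0 ≤ j ≤ k−1, one has (k − j)·c_j + (j + 1)·c_{j+1} = 0 in F_p. -/
open Polynomial

theorem coeff_X_pow_add_one_pow_mul_X_add_one_pow {R : Type*} [CommSemiring R] {p i b : ℕ}
    (hi : i < p) (hb : b < p) (m a : ℕ) :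
    ((((X : R[X]) ^ p + 1) ^ m) * (X + 1) ^ i).coeff (a * p + b) =
      (m.choose a : R) * (i.choose b : R) := by
  have hterm (e : ℕ) : ((X ^ p) ^ e * 1 ^ (m - e) * (m.choose e : R[X]) * (X + 1) ^ i).coeff
      (a * p + b) = if e = a then (m.choose a : R) * (i.choose b : R) else 0 := by
    have hrw : (X ^ p) ^ e * 1 ^ (m - e) * (m.choose e : R[X]) * (X + 1) ^ i =
        C (m.choose e : R) * ((X + 1) ^ i * X ^ (e * p)) := by
      rw [one_pow, ← pow_mul, mul_comm p e, C_eq_natCast]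
      ring
    rw [hrw, coeff_C_mul, coeff_mul_X_pow']
    rcases lt_trichotomy e a with h | rfl | h
    · have h1 : (e + 1) * p ≤ a * p := Nat.mul_le_mul_right p h
      rw [add_one_mul] at h1
      rw [if_pos (by omega), if_neg h.ne, coeff_X_add_one_pow,
        Nat.choose_eq_zero_of_lt (show i < a * p + b - e * p by omega), Nat.cast_zero, mul_zero]
    · rw [if_pos (by omega), if_pos rfl, coeff_X_add_one_pow, Nat.add_sub_cancel_left]
    · have h1 : (a + 1) * p ≤ e * p := Nat.mul_le_mul_right p h
      rw [add_one_mul] at h1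
      rw [if_neg (by omega), if_neg h.ne', mul_zero]
  rw [add_pow, Finset.sum_mul, finsetSum_coeff, Finset.sum_congr rfl fun e _ => hterm e,
    Finset.sum_ite_eq']
  split_ifs with h
  · rfl
  · rw [Nat.choose_eq_zero_of_lt (by simpa [Nat.lt_succ_iff] using h), Nat.cast_zero, zero_mul]

theorem stmt_17 (p : ℕ) (hp : p.Prime) (hp3 : 3 ≤ p) (k : ℕ) (hk1 : 1 ≤ k) (hkp : k ≤ p - 1)
    (c : ℕ → ZMod p) (g : Polynomial (ZMod p))
    (hg : g = X + ∑ j ∈ Finset.range (k + 1), C (c j) * X ^ ((k - j) * p + j))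
    (hcomm : (X + 1).comp g = g.comp (X + 1)) :
    ∀ j : ℕ, j ≤ k - 1 → ((k - j : ℕ) : ZMod p) * c j + ((j + 1 : ℕ) : ZMod p) * c (j + 1) = 0 := by
  intro j hj
  have : Fact p.Prime := ⟨hp⟩
  have hinv : ∑ i ∈ Finset.range (k + 1), C (c i) * X ^ ((k - i) * p + i) =
      ∑ i ∈ Finset.range (k + 1),
        C (c i) * (((X : (ZMod p)[X]) ^ p + 1) ^ (k - i) * (X + 1) ^ i) := by
    have hpow (i : ℕ) : ((X : (ZMod p)[X]) + 1) ^ ((k - i) * p + i) =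
        (X ^ p + 1) ^ (k - i) * (X + 1) ^ i := by
      rw [pow_add, mul_comm (k - i) p, pow_mul, add_pow_char (X : (ZMod p)[X]) 1 p, one_pow]
    rw [hg] at hcomm
    simp only [add_comp, X_comp, one_comp, Polynomial.sum_comp, mul_comp, C_comp, pow_comp,
      hpow] at hcomm
    linear_combination hcomm
  have hcoeff := congrArg (fun q => q.coeff ((k - 1 - j) * p + j)) hinv
  simp only [finsetSum_coeff, coeff_C_mul] at hcoeff
  rw [Finset.sum_eq_zero, Finset.sum_congr rfl fun i hi => by
    rw [coeff_X_pow_add_one_pow_mul_X_add_one_pow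
      (by have := Finset.mem_range.mp hi; omega) (by omega)]] at hcoeff
  · rw [Finset.sum_eq_add_of_mem j (j + 1) (by simp; omega) (by simp; omega) (by omega)] at hcoeff
    · have h1 : (k - j).choose (k - 1 - j) = k - j := by
        obtain ⟨m, rfl⟩ : ∃ m, k = j + m + 1 := ⟨k - 1 - j, by omega⟩
        rw [show j + m + 1 - j = m + 1 by omega, show j + m + 1 - 1 - j = m by omega,
          Nat.choose_succ_self_right]
      rw [h1, show k - (j + 1) = k - 1 - j by omega, Nat.choose_self, Nat.choose_self,
        Nat.choose_succ_self_right] at hcoeff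
      rw [Nat.cast_one] at hcoeff
      linear_combination -hcoeff
    · intro i hi hne
      have hi' := Finset.mem_range.mp hi
      rcases lt_or_gt_of_ne hne.1 with h | h
      · rw [Nat.choose_eq_zero_of_lt h, Nat.cast_zero, mul_zero, mul_zero]
      · rw [Nat.choose_eq_zero_of_lt (show k - i < k - 1 - j by omega), Nat.cast_zero, zero_mul,
          mul_zero]
  · intro i hi
    have hi' := Finset.mem_range.mp hi
    rw [coeff_X_pow, if_neg, mul_zero]
    intro h
    have hmod := congrArg (· % p) h
    simp only [Nat.mul_add_mod_self_right, Nat.mod_eq_of_lt (show i < p by omega),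
      Nat.mod_eq_of_lt (show j < p by omega)] at hmod
    subst hmod
    have := Nat.eq_of_mul_eq_mul_right hp.pos (Nat.add_right_cancel h)
    omega
end

section
/- Let p ≥ 3 be a prime and let k be an integer with 1 ≤ k ≤ p−1. Suppose g ∈ F_p[x] has the form g = x + Σ_{j=0}^{k} c_j · x^{(k−j)p + j} for some coefficients c_0, …, c_k ∈ F_p, and suppose (x+1) ∘ g = g ∘ (x+1). Then for every integer j with 0 ≤ j ≤ k, one has c_j = (−1)^j · C(k, j) · c_0 in F_p, where c_0 is the coefficient of the top-degree term x^{kp}. -/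
open Polynomial

/-- Lucas' theorem for two-digit numbers in base `p`, in `ZMod p`. -/
lemma ZMod.choose_mul_add_eq {p : ℕ} [Fact p.Prime] (m a : ℕ) {i b : ℕ} (hi : i < p) (hb : b < p) :
    (((m * p + i).choose (a * p + b) : ℕ) : ZMod p) = (m.choose a : ZMod p) * (i.choose b : ZMod p) := by
  have hp : 0 < p := (Fact.out : p.Prime).pos
  have hdiv : ∀ n r : ℕ, r < p → (n * p + r) / p = n := fun n r hr => by
    rw [mul_comm, Nat.mul_add_div hp, Nat.div_eq_of_lt hr, add_zero]
  have hmod : ∀ n r : ℕ, r < p → (n * p + r) % p = r := fun n r hr => by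
    rw [mul_comm, Nat.mul_add_mod, Nat.mod_eq_of_lt hr]
  have h := (ZMod.intCast_eq_intCast_iff _ _ p).mpr
    (Choose.choose_modEq_choose_mod_mul_choose_div (n := m * p + i) (k := a * p + b) (p := p))
  rw [hdiv m i hi, hdiv a b hb, hmod m i hi, hmod a b hb] at h
  push_cast at h
  rw [h, mul_comm]

/-- A translation-invariant combination of the monomials `X ^ ((k - j) * p + j)` has coefficients
satisfying a two-term recurrence. -/
lemma Polynomial.recurrence_of_translation_invariant {p : ℕ} [Fact p.Prime] {k : ℕ} (hk : k < p)
    (c : ℕ → ZMod p)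
    (h : ∑ i ∈ Finset.range (k + 1), C (c i) * X ^ ((k - i) * p + i) =
      ∑ i ∈ Finset.range (k + 1), C (c i) * (X + 1) ^ ((k - i) * p + i))
    {j : ℕ} (hj : j < k) :
    c j * ((k - j : ℕ) : ZMod p) + c (j + 1) * ((j + 1 : ℕ) : ZMod p) = 0 := by
  have h := congrArg (fun q => q.coeff ((k - 1 - j) * p + j)) h
  simp only [finsetSum_coeff, coeff_C_mul, coeff_X_pow, coeff_X_add_one_pow] at h
  rw [Finset.sum_eq_zero, Finset.sum_eq_add_of_mem j (j + 1)] at h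
  · rw [ZMod.choose_mul_add_eq _ _ (by omega) (by omega),
      ZMod.choose_mul_add_eq _ _ (by omega) (by omega),
      show k - (j + 1) = k - 1 - j by omega, show k - j = k - 1 - j + 1 by omega,
      Nat.choose_succ_self_right, Nat.choose_succ_self_right, Nat.choose_self, Nat.choose_self] at h
    rw [show k - j = k - 1 - j + 1 by omega, h]
    simp
  · simp; omega
  · simp; omega
  · omega
  · intro i hi hne
    rw [Finset.mem_range] at hi
    rw [ZMod.choose_mul_add_eq _ _ (by omega) (by omega)]
    rcases lt_or_ge i j with hij | hij
    · simp [Nat.choose_eq_zero_of_lt hij]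
    · rw [Nat.choose_eq_zero_of_lt (show k - i < k - 1 - j by omega)]
      simp
  · intro i hi
    rw [Finset.mem_range] at hi
    rw [if_neg, mul_zero]
    intro he
    have hp : 0 < p := by omega
    have hm := congrArg (· % p) he
    simp only [Nat.mul_add_mod_self_right, Nat.mod_eq_of_lt (show i < p by omega),
      Nat.mod_eq_of_lt (show j < p by omega)] at hm
    subst hm
    have := Nat.eq_of_mul_eq_mul_right hp (Nat.add_right_cancel he)
    omega

theorem stmt_18 (p : ℕ) (hp : p.Prime) (hp3 : 3 ≤ p) (k : ℕ) (hk1 : 1 ≤ k) (hkp : k ≤ p - 1)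
    (c : ℕ → ZMod p) (g : Polynomial (ZMod p))
    (hg : g = X + ∑ j ∈ Finset.range (k + 1), C (c j) * X ^ ((k - j) * p + j))
    (hcomm : (X + 1).comp g = g.comp (X + 1)) :
    ∀ j : ℕ, j ≤ k → c j = (-1) ^ j * (Nat.choose k j : ZMod p) * c 0 := by
  have := Fact.mk hp
  have hsum : ∑ i ∈ Finset.range (k + 1), C (c i) * X ^ ((k - i) * p + i) =
      ∑ i ∈ Finset.range (k + 1), C (c i) * (X + 1) ^ ((k - i) * p + i) := by
    simp only [hg, add_comp, X_comp, one_comp, sum_comp, mul_comp, C_comp,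
      X_pow_comp] at hcomm
    linear_combination hcomm
  intro j
  induction j with
  | zero => simp
  | succ j ih =>
    intro hj
    have hrec := recurrence_of_translation_invariant (by omega) c hsum hj
    rw [ih (by omega)] at hrec
    have hne : ((j + 1 : ℕ) : ZMod p) ≠ 0 := by
      rw [Ne, ZMod.natCast_eq_zero_iff]
      exact Nat.not_dvd_of_pos_of_lt (by omega) (by omega)
    have hchoose := congrArg (Nat.cast : ℕ → ZMod p) (Nat.choose_succ_right_eq k j)
    rw [Nat.cast_mul, Nat.cast_mul] at hchoose
    apply mul_right_cancel₀ hne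
    linear_combination hrec + (-1) ^ j * c 0 * hchoose
end
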